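/- The function A is strictly positive and strictly decreasing on (0,∞), and the function x ↦ −(log φ)″(x) = x·A(x) + A(x)² is strictly decreasing on (0,∞). -/

import Mathlib

open MeasureTheory Filter Topology

/-- `φ(x) = ∫_0^x exp(-y²/2) dy`. -/
noncomputable def phi (x : ℝ) : ℝ := ∫ y in (0:ℝ)..x, Real.exp (-(y ^ 2) / 2)

/-- `A(x) = exp(-x²/2) / φ(x)`, the derivative of `log φ` on `(0,∞)`. -/
noncomputable def Afun (x : ℝ) : ℝ := Real.exp (-(x ^ 2) / 2) / phi x

theorem hasDerivAt_phi (x : ℝ) : HasDerivAt phi (Real.exp (-(x ^ 2) / 2)) x := by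
  have hc : Continuous fun y : ℝ => Real.exp (-(y ^ 2) / 2) := by fun_prop
  exact intervalIntegral.integral_hasDerivAt_right (hc.intervalIntegrable _ _)
    hc.stronglyMeasurable.stronglyMeasurableAtFilter hc.continuousAt

theorem phi_pos {x : ℝ} (hx : 0 < x) : 0 < phi x := by
  have hc : Continuous fun y : ℝ => Real.exp (-(y ^ 2) / 2) := by fun_prop
  exact intervalIntegral.intervalIntegral_pos_of_pos (hc.intervalIntegrable _ _)
    (fun _ => Real.exp_pos _) hx

theorem phi_le_self {x : ℝ} (hx : 0 < x) : phi x ≤ x := by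
  have hc : Continuous fun y : ℝ => Real.exp (-(y ^ 2) / 2) := by fun_prop
  have h := intervalIntegral.integral_mono_on (μ := volume) hx.le (hc.intervalIntegrable 0 x)
    ((continuous_const (y := (1 : ℝ))).intervalIntegrable 0 x)
    (fun y _ => Real.exp_le_one_iff.2 (by nlinarith [sq_nonneg y]))
  simpa [phi] using h

theorem Afun_pos {x : ℝ} (hx : 0 < x) : 0 < Afun x :=
  div_pos (Real.exp_pos _) (phi_pos hx)

theorem hasDerivAt_log_phi {x : ℝ} (hx : 0 < x) :
    HasDerivAt (fun z => Real.log (phi z)) (Afun x) x :=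
  (hasDerivAt_phi x).log (phi_pos hx).ne'

theorem hasDerivAt_Afun {x : ℝ} (hx : 0 < x) :
    HasDerivAt Afun (-(x * Afun x + Afun x ^ 2)) x := by
  have hp := (phi_pos hx).ne'
  have he : HasDerivAt (fun y : ℝ => Real.exp (-(y ^ 2) / 2))
      (Real.exp (-(x ^ 2) / 2) * (-(2 * x) / 2)) x := by
    have h := (((hasDerivAt_pow 2 x).fun_neg).div_const 2).exp
    simpa using h
  refine (he.fun_div (hasDerivAt_phi x) hp).congr_deriv ?_
  unfold Afun
  field_simp
  ring

theorem hasDerivAt_mul_Afun_add_sq {x : ℝ} (hx : 0 < x) :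
    HasDerivAt (fun x => x * Afun x + Afun x ^ 2)
      (Afun x * (1 - (x + 2 * Afun x) * (x + Afun x))) x := by
  have hA := hasDerivAt_Afun hx
  refine (((hasDerivAt_id' x).fun_mul hA).fun_add (hA.fun_pow 2)).congr_deriv ?_
  ring

/-- The bound `exp (-x ^ 2) ≥ 1 - x ^ 2` together with `phi x ≤ x`. -/
theorem one_sub_sq_le_sq_mul_Afun_sq {x : ℝ} (hx : 0 < x) :
    1 - x ^ 2 ≤ (x * Afun x) ^ 2 := by
  have hE : Real.exp (-(x ^ 2) / 2) ≤ x * Afun x := by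
    have h := mul_le_mul_of_nonneg_right (phi_le_self hx) (Afun_pos hx).le
    rwa [Afun, mul_div_cancel₀ _ (phi_pos hx).ne'] at h
  calc 1 - x ^ 2 ≤ Real.exp (-x ^ 2) := by linarith [Real.add_one_le_exp (-x ^ 2)]
    _ = Real.exp (-(x ^ 2) / 2) ^ 2 := by rw [← Real.exp_nat_mul]; congr 1; push_cast; ring
    _ ≤ (x * Afun x) ^ 2 := pow_le_pow_left₀ (Real.exp_pos _).le hE 2

theorem one_lt_add_two_mul_Afun_mul {x : ℝ} (hx : 0 < x) :
    1 < (x + 2 * Afun x) * (x + Afun x) := by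
  have hA := Afun_pos hx
  have hxA := mul_pos hx hA
  have h := one_sub_sq_le_sq_mul_Afun_sq hx
  rcases le_or_gt 1 x with h1 | h1
  · nlinarith [sq_nonneg (Afun x)]
  · have : x ^ 2 * Afun x ^ 2 ≤ Afun x ^ 2 :=
      mul_le_of_le_one_left (sq_nonneg _) (by nlinarith)
    nlinarith [pow_pos hA 2]

theorem strictAntiOn_Ioi_of_hasDerivAt_neg {f f' : ℝ → ℝ} {a : ℝ}
    (hf : ∀ x, a < x → HasDerivAt f (f' x) x) (hneg : ∀ x, a < x → f' x < 0) :
    StrictAntiOn f (Set.Ioi a) := by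
  refine strictAntiOn_of_deriv_neg (convex_Ioi a)
    (fun x hx => (hf x hx).continuousAt.continuousWithinAt) fun x hx => ?_
  rw [interior_Ioi] at hx
  rw [(hf x hx).deriv]
  exact hneg x hx

/-- `A` is strictly positive and strictly decreasing on `(0,∞)`, and the
function `x ↦ -(log φ)″(x) = x·A(x) + A(x)²` is strictly decreasing on `(0,∞)`. -/
theorem statement14 :
    (∀ x : ℝ, 0 < x → 0 < Afun x) ∧
    StrictAntiOn Afun (Set.Ioi 0) ∧
    (∀ x : ℝ, 0 < x →
      -(iteratedDeriv 2 (fun z => Real.log (phi z)) x) = x * Afun x + (Afun x) ^ 2) ∧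
    StrictAntiOn (fun x => x * Afun x + (Afun x) ^ 2) (Set.Ioi 0) := by
  refine ⟨fun x hx => Afun_pos hx, ?_, fun x hx => ?_, ?_⟩
  · refine strictAntiOn_Ioi_of_hasDerivAt_neg (fun x hx => hasDerivAt_Afun hx) fun x hx => ?_
    have hA := Afun_pos hx
    exact neg_neg_of_pos (by positivity)
  · have h : deriv (fun z => Real.log (phi z)) =ᶠ[𝓝 x] Afun := by
      filter_upwards [Ioi_mem_nhds hx] with y hy
      exact (hasDerivAt_log_phi hy).deriv
    rw [iteratedDeriv_succ, iteratedDeriv_one, h.deriv_eq, (hasDerivAt_Afun hx).deriv, neg_neg]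
  · exact strictAntiOn_Ioi_of_hasDerivAt_neg (fun x hx => hasDerivAt_mul_Afun_add_sq hx)
      fun x hx => mul_neg_of_pos_of_neg (Afun_pos hx)
        (sub_neg.2 (one_lt_add_two_mul_Afun_mul hx))
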